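/- arXiv:2503.15486 — 2 statements merged into one kernel-verified Lean document; each statement's English description precedes it below -/
import Mathlib

section
/- Consider the game with control bounds. If both agents' constrained feedback KKT systems hold ((FB1), (FB2'), (FB3), (FB4) with bound-multiplier nonnegativity and complementarity) and the strict-complementarity policy dichotomy holds, then: λ²_t = −λ¹_t for all t = 1,…,K; ψ¹_s = ν̄²_s − ν̲²_s and ψ²_s = ν̄¹_s − ν̲¹_s for all s = 2,…,K; and (D_x π^{−i}_s(x_s))^⊤ ψ^i_s = 0 for all s = 2,…,K and i = 1,2. -/
open Matrix

noncomputable def grad {p : ℕ} (G : (Fin p → ℝ) → ℝ) (a : Fin p → ℝ) : Fin p → ℝ :=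
  fun j => fderiv ℝ G a (Pi.single j 1)

noncomputable def jacT {p q : ℕ} (F : (Fin p → ℝ) → Fin q → ℝ) (a : Fin p → ℝ)
    (lam : Fin q → ℝ) : Fin p → ℝ :=
  fun j => lam ⬝ᵥ fderiv ℝ F a (Pi.single j 1)

theorem grad_neg {p : ℕ} (G : (Fin p → ℝ) → ℝ) (a : Fin p → ℝ) :
    grad (fun w => -(G w)) a = -grad G a := by
  ext j
  simp [grad, fderiv_fun_neg]

theorem jacT_neg {p q : ℕ} (F : (Fin p → ℝ) → Fin q → ℝ) (a : Fin p → ℝ) (lam : Fin q → ℝ) :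
    jacT F a (-lam) = -jacT F a lam := by
  ext j
  simp [jacT]

/-- A transposed Jacobian annihilates a multiplier supported on the vanishing rows. -/
theorem jacT_eq_zero {p q : ℕ} {F : (Fin p → ℝ) → Fin q → ℝ} {a : Fin p → ℝ} {lam : Fin q → ℝ}
    (h : ∀ i, (∀ v, fderiv ℝ F a v i = 0) ∨ lam i = 0) : jacT F a lam = 0 := by
  ext j
  simp only [jacT, dotProduct, Pi.zero_apply]
  refine Finset.sum_eq_zero fun i _ => ?_
  rcases h i with hi | hi <;> simp [hi]

/-- Control-bounded game: under both agents' constrained feedback KKT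
systems and the strict-complementarity policy dichotomy, the adjoint multipliers are
antisymmetric, `ψⁱ_s = ν̄⁻ⁱ_s - ν̲⁻ⁱ_s`, and `(D_x π⁻ⁱ_s)ᵀ ψⁱ_s = 0`. -/
theorem constrained_fbne_multiplier_structure
    {n m1 m2 K : ℕ} (hK : 1 ≤ K)
    (f : ℕ → (Fin n → ℝ) → (Fin m1 → ℝ) → (Fin m2 → ℝ) → Fin n → ℝ)
    (l : ℕ → (Fin n → ℝ) → (Fin m1 → ℝ) → (Fin m2 → ℝ) → ℝ)
    (lf : (Fin n → ℝ) → ℝ)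
    (x : ℕ → Fin n → ℝ) (u1 : ℕ → Fin m1 → ℝ) (u2 : ℕ → Fin m2 → ℝ)
    (pi1 : ℕ → (Fin n → ℝ) → Fin m1 → ℝ) (pi2 : ℕ → (Fin n → ℝ) → Fin m2 → ℝ)
    (lam1 lam2 : ℕ → Fin n → ℝ)
    (psi1 : ℕ → Fin m2 → ℝ) (psi2 : ℕ → Fin m1 → ℝ)
    (a1 b1 : ℕ → Fin m1 → ℝ) (a2 b2 : ℕ → Fin m2 → ℝ)
    (lo1 hi1 : ℕ → Fin m1 → ℝ) (lo2 hi2 : ℕ → Fin m2 → ℝ)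
    (hfd : ∀ t, 1 ≤ t → t ≤ K → Differentiable ℝ
      (fun p : (Fin n → ℝ) × (Fin m1 → ℝ) × (Fin m2 → ℝ) => f t p.1 p.2.1 p.2.2))
    (hld : ∀ t, 1 ≤ t → t ≤ K → Differentiable ℝ
      (fun p : (Fin n → ℝ) × (Fin m1 → ℝ) × (Fin m2 → ℝ) => l t p.1 p.2.1 p.2.2))
    (hlfd : Differentiable ℝ lf)
    (hpi1d : ∀ s, 2 ≤ s → s ≤ K → Differentiable ℝ (pi1 s))
    (hpi2d : ∀ s, 2 ≤ s → s ≤ K → Differentiable ℝ (pi2 s))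
    (hdyn : ∀ t, 1 ≤ t → t ≤ K → x (t+1) = f t (x t) (u1 t) (u2 t))
    (hpc1 : ∀ s, 2 ≤ s → s ≤ K → pi1 s (x s) = u1 s)
    (hpc2 : ∀ s, 2 ≤ s → s ≤ K → pi2 s (x s) = u2 s)
    (hb1 : ∀ t, 1 ≤ t → t ≤ K → ∀ j, a1 t j ≤ u1 t j ∧ u1 t j ≤ b1 t j)
    (hb2 : ∀ t, 1 ≤ t → t ≤ K → ∀ j, a2 t j ≤ u2 t j ∧ u2 t j ≤ b2 t j)
    (hnn1 : ∀ t, 1 ≤ t → t ≤ K → ∀ j, 0 ≤ lo1 t j ∧ 0 ≤ hi1 t j)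
    (hnn2 : ∀ t, 1 ≤ t → t ≤ K → ∀ j, 0 ≤ lo2 t j ∧ 0 ≤ hi2 t j)
    (hcp1 : ∀ t, 1 ≤ t → t ≤ K → ∀ j,
      lo1 t j * (u1 t j - a1 t j) = 0 ∧ hi1 t j * (b1 t j - u1 t j) = 0)
    (hcp2 : ∀ t, 1 ≤ t → t ≤ K → ∀ j,
      lo2 t j * (u2 t j - a2 t j) = 0 ∧ hi2 t j * (b2 t j - u2 t j) = 0)
    (hsc1 : ∀ s, 2 ≤ s → s ≤ K → ∀ j : Fin m1,
      (∀ v, fderiv ℝ (pi1 s) (x s) v j = 0) ∨ (lo1 s j = 0 ∧ hi1 s j = 0))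
    (hsc2 : ∀ s, 2 ≤ s → s ≤ K → ∀ j : Fin m2,
      (∀ v, fderiv ℝ (pi2 s) (x s) v j = 0) ∨ (lo2 s j = 0 ∧ hi2 s j = 0))
    (hFB1a : ∀ s, 2 ≤ s → s ≤ K → grad (fun w => l s (x s) (u1 s) w) (u2 s)
      + jacT (fun w => f s (x s) (u1 s) w) (u2 s) (lam1 s) - psi1 s = 0)
    (hFB1b : ∀ s, 2 ≤ s → s ≤ K → grad (fun w => -(l s (x s) w (u2 s))) (u1 s)
      + jacT (fun w => f s (x s) w (u2 s)) (u1 s) (lam2 s) - psi2 s = 0)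
    (hFB2a : ∀ t, 1 ≤ t → t ≤ K → grad (fun w => l t (x t) w (u2 t)) (u1 t)
      + jacT (fun w => f t (x t) w (u2 t)) (u1 t) (lam1 t) - lo1 t + hi1 t = 0)
    (hFB2b : ∀ t, 1 ≤ t → t ≤ K → grad (fun w => -(l t (x t) (u1 t) w)) (u2 t)
      + jacT (fun w => f t (x t) (u1 t) w) (u2 t) (lam2 t) - lo2 t + hi2 t = 0)
    (hFB3a : grad lf (x (K+1)) - lam1 K = 0)
    (hFB3b : grad (fun y => -(lf y)) (x (K+1)) - lam2 K = 0)
    (hFB4a : ∀ s, 2 ≤ s → s ≤ K → grad (fun y => l s y (u1 s) (u2 s)) (x s) - lam1 (s-1)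
      + jacT (fun y => f s y (u1 s) (u2 s)) (x s) (lam1 s) + jacT (pi2 s) (x s) (psi1 s) = 0)
    (hFB4b : ∀ s, 2 ≤ s → s ≤ K → grad (fun y => -(l s y (u1 s) (u2 s))) (x s) - lam2 (s-1)
      + jacT (fun y => f s y (u1 s) (u2 s)) (x s) (lam2 s) + jacT (pi1 s) (x s) (psi2 s) = 0)
 :
    (∀ t, 1 ≤ t → t ≤ K → lam2 t = -lam1 t) ∧
    (∀ s, 2 ≤ s → s ≤ K → psi1 s = hi2 s - lo2 s ∧ psi2 s = hi1 s - lo1 s) ∧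
    (∀ s, 2 ≤ s → s ≤ K →
      jacT (pi2 s) (x s) (psi1 s) = 0 ∧ jacT (pi1 s) (x s) (psi2 s) = 0) := by
  have multipliers : ∀ s, 2 ≤ s → s ≤ K → lam2 s = -lam1 s →
      psi1 s = hi2 s - lo2 s ∧ psi2 s = hi1 s - lo1 s := by
    intro s hs hsK hlam
    have e1 := hFB1a s hs hsK
    have e2 := hFB1b s hs hsK
    have e3 := hFB2a s (by omega) hsK
    have e4 := hFB2b s (by omega) hsK
    rw [hlam, grad_neg, jacT_neg] at e2 e4
    constructor
    · linear_combination -e1 - e4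
    · linear_combination -e2 - e3
  have annihilation : ∀ s, 2 ≤ s → s ≤ K → lam2 s = -lam1 s →
      jacT (pi2 s) (x s) (psi1 s) = 0 ∧ jacT (pi1 s) (x s) (psi2 s) = 0 := by
    intro s hs hsK hlam
    obtain ⟨h1, h2⟩ := multipliers s hs hsK hlam
    rw [h1, h2]
    exact ⟨jacT_eq_zero fun j => (hsc2 s hs hsK j).imp_right fun h => by simp [h.1, h.2],
      jacT_eq_zero fun j => (hsc1 s hs hsK j).imp_right fun h => by simp [h.1, h.2]⟩
  have antisymmetry : ∀ t, 1 ≤ t → t ≤ K → lam2 t = -lam1 t := by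
    intro t ht htK
    induction htK using Nat.decreasingInduction with
    | self =>
      rw [grad_neg] at hFB3b
      linear_combination -hFB3a - hFB3b
    | of_succ t htK ih =>
      have hlam := ih (by omega)
      have h1 := hFB4a (t + 1) (by omega) htK
      have h2 := hFB4b (t + 1) (by omega) htK
      obtain ⟨z1, z2⟩ := annihilation (t + 1) (by omega) htK hlam
      rw [z1, Nat.add_sub_cancel] at h1
      rw [z2, hlam, grad_neg, jacT_neg, Nat.add_sub_cancel] at h2
      linear_combination -h1 - h2
  exact ⟨antisymmetry,
    fun s hs hsK => multipliers s hs hsK (antisymmetry s (by omega) hsK),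
    fun s hs hsK => annihilation s hs hsK (antisymmetry s (by omega) hsK)⟩
end

section
/- Consider the game with control bounds. If both agents' constrained feedback KKT systems hold and the strict-complementarity policy dichotomy holds, then the same trajectory with the same multipliers λ^i, ν̲^i, ν̄^i satisfies both agents' constrained open-loop KKT systems: (OL1) ∇_x g^i_t + (D_x f_t)^⊤ λ^i_t − λ^i_{t−1} = 0 for t = 2,…,K; (OL2') ∇_{u^i} g^i_t + (D_{u^i} f_t)^⊤ λ^i_t − ν̲^i_t + ν̄^i_t = 0 for t = 1,…,K; (OL3) ∇g^i_{K+1}(x_{K+1}) − λ^i_K = 0; together with the bounds, nonnegativity, and complementarity conditions. (Theorem 2, part 1: any local FBNE of the control-bounded game at which strict complementarity holds satisfies the first-order necessary conditions for a local OLNE.) -/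
open Matrix

theorem grad_fun_neg {p : ℕ} (G : (Fin p → ℝ) → ℝ) (a : Fin p → ℝ) :
    grad (fun y => -(G y)) a = -grad G a := by
  ext j
  simp [grad, fderiv_fun_neg]

/-- A multiplier supported on the components whose Jacobian row vanishes is annihilated by the
transposed Jacobian. -/
theorem jacT_sub_eq_zero {p q : ℕ} (F : (Fin p → ℝ) → Fin q → ℝ) (a : Fin p → ℝ)
    (lo hi : Fin q → ℝ)
    (h : ∀ j, (∀ v, fderiv ℝ F a v j = 0) ∨ (lo j = 0 ∧ hi j = 0)) :
    jacT F a (hi - lo) = 0 := by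
  ext i
  show ∑ j, (hi - lo) j * fderiv ℝ F a (Pi.single i 1) j = 0
  refine Finset.sum_eq_zero fun j _ => ?_
  rcases h j with hrow | ⟨hlo, hhi⟩
  · rw [hrow, mul_zero]
  · simp [hlo, hhi]

/-- (Theorem 2, part 1.) Control-bounded game: a trajectory satisfying
both agents' constrained feedback KKT systems, at which the strict-complementarity policy
dichotomy holds, also satisfies both agents' constrained open-loop KKT systems with the
same multipliers `λⁱ, ν̲ⁱ, ν̄ⁱ`. -/
theorem constrained_fbne_implies_olne_first_order
    {n m1 m2 K : ℕ} (hK : 1 ≤ K)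
    (f : ℕ → (Fin n → ℝ) → (Fin m1 → ℝ) → (Fin m2 → ℝ) → Fin n → ℝ)
    (l : ℕ → (Fin n → ℝ) → (Fin m1 → ℝ) → (Fin m2 → ℝ) → ℝ)
    (lf : (Fin n → ℝ) → ℝ)
    (x : ℕ → Fin n → ℝ) (u1 : ℕ → Fin m1 → ℝ) (u2 : ℕ → Fin m2 → ℝ)
    (pi1 : ℕ → (Fin n → ℝ) → Fin m1 → ℝ) (pi2 : ℕ → (Fin n → ℝ) → Fin m2 → ℝ)
    (lam1 lam2 : ℕ → Fin n → ℝ)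
    (psi1 : ℕ → Fin m2 → ℝ) (psi2 : ℕ → Fin m1 → ℝ)
    (a1 b1 : ℕ → Fin m1 → ℝ) (a2 b2 : ℕ → Fin m2 → ℝ)
    (lo1 hi1 : ℕ → Fin m1 → ℝ) (lo2 hi2 : ℕ → Fin m2 → ℝ)
    (hfd : ∀ t, 1 ≤ t → t ≤ K → Differentiable ℝ
      (fun p : (Fin n → ℝ) × (Fin m1 → ℝ) × (Fin m2 → ℝ) => f t p.1 p.2.1 p.2.2))
    (hld : ∀ t, 1 ≤ t → t ≤ K → Differentiable ℝ
      (fun p : (Fin n → ℝ) × (Fin m1 → ℝ) × (Fin m2 → ℝ) => l t p.1 p.2.1 p.2.2))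
    (hlfd : Differentiable ℝ lf)
    (hpi1d : ∀ s, 2 ≤ s → s ≤ K → Differentiable ℝ (pi1 s))
    (hpi2d : ∀ s, 2 ≤ s → s ≤ K → Differentiable ℝ (pi2 s))
    (hdyn : ∀ t, 1 ≤ t → t ≤ K → x (t+1) = f t (x t) (u1 t) (u2 t))
    (hpc1 : ∀ s, 2 ≤ s → s ≤ K → pi1 s (x s) = u1 s)
    (hpc2 : ∀ s, 2 ≤ s → s ≤ K → pi2 s (x s) = u2 s)
    (hb1 : ∀ t, 1 ≤ t → t ≤ K → ∀ j, a1 t j ≤ u1 t j ∧ u1 t j ≤ b1 t j)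
    (hb2 : ∀ t, 1 ≤ t → t ≤ K → ∀ j, a2 t j ≤ u2 t j ∧ u2 t j ≤ b2 t j)
    (hnn1 : ∀ t, 1 ≤ t → t ≤ K → ∀ j, 0 ≤ lo1 t j ∧ 0 ≤ hi1 t j)
    (hnn2 : ∀ t, 1 ≤ t → t ≤ K → ∀ j, 0 ≤ lo2 t j ∧ 0 ≤ hi2 t j)
    (hcp1 : ∀ t, 1 ≤ t → t ≤ K → ∀ j,
      lo1 t j * (u1 t j - a1 t j) = 0 ∧ hi1 t j * (b1 t j - u1 t j) = 0)
    (hcp2 : ∀ t, 1 ≤ t → t ≤ K → ∀ j,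
      lo2 t j * (u2 t j - a2 t j) = 0 ∧ hi2 t j * (b2 t j - u2 t j) = 0)
    (hsc1 : ∀ s, 2 ≤ s → s ≤ K → ∀ j : Fin m1,
      (∀ v, fderiv ℝ (pi1 s) (x s) v j = 0) ∨ (lo1 s j = 0 ∧ hi1 s j = 0))
    (hsc2 : ∀ s, 2 ≤ s → s ≤ K → ∀ j : Fin m2,
      (∀ v, fderiv ℝ (pi2 s) (x s) v j = 0) ∨ (lo2 s j = 0 ∧ hi2 s j = 0))
    (hFB1a : ∀ s, 2 ≤ s → s ≤ K → grad (fun w => l s (x s) (u1 s) w) (u2 s)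
      + jacT (fun w => f s (x s) (u1 s) w) (u2 s) (lam1 s) - psi1 s = 0)
    (hFB1b : ∀ s, 2 ≤ s → s ≤ K → grad (fun w => -(l s (x s) w (u2 s))) (u1 s)
      + jacT (fun w => f s (x s) w (u2 s)) (u1 s) (lam2 s) - psi2 s = 0)
    (hFB2a : ∀ t, 1 ≤ t → t ≤ K → grad (fun w => l t (x t) w (u2 t)) (u1 t)
      + jacT (fun w => f t (x t) w (u2 t)) (u1 t) (lam1 t) - lo1 t + hi1 t = 0)
    (hFB2b : ∀ t, 1 ≤ t → t ≤ K → grad (fun w => -(l t (x t) (u1 t) w)) (u2 t)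
      + jacT (fun w => f t (x t) (u1 t) w) (u2 t) (lam2 t) - lo2 t + hi2 t = 0)
    (hFB3a : grad lf (x (K+1)) - lam1 K = 0)
    (hFB3b : grad (fun y => -(lf y)) (x (K+1)) - lam2 K = 0)
    (hFB4a : ∀ s, 2 ≤ s → s ≤ K → grad (fun y => l s y (u1 s) (u2 s)) (x s) - lam1 (s-1)
      + jacT (fun y => f s y (u1 s) (u2 s)) (x s) (lam1 s) + jacT (pi2 s) (x s) (psi1 s) = 0)
    (hFB4b : ∀ s, 2 ≤ s → s ≤ K → grad (fun y => -(l s y (u1 s) (u2 s))) (x s) - lam2 (s-1)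
      + jacT (fun y => f s y (u1 s) (u2 s)) (x s) (lam2 s) + jacT (pi1 s) (x s) (psi2 s) = 0)
 :
    (∀ t, 2 ≤ t → t ≤ K → grad (fun y => l t y (u1 t) (u2 t)) (x t)
      + jacT (fun y => f t y (u1 t) (u2 t)) (x t) (lam1 t) - lam1 (t-1) = 0) ∧
    (∀ t, 1 ≤ t → t ≤ K → grad (fun w => l t (x t) w (u2 t)) (u1 t)
      + jacT (fun w => f t (x t) w (u2 t)) (u1 t) (lam1 t) - lo1 t + hi1 t = 0) ∧
    (grad lf (x (K+1)) - lam1 K = 0) ∧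
    (∀ t, 2 ≤ t → t ≤ K → grad (fun y => -(l t y (u1 t) (u2 t))) (x t)
      + jacT (fun y => f t y (u1 t) (u2 t)) (x t) (lam2 t) - lam2 (t-1) = 0) ∧
    (∀ t, 1 ≤ t → t ≤ K → grad (fun w => -(l t (x t) (u1 t) w)) (u2 t)
      + jacT (fun w => f t (x t) (u1 t) w) (u2 t) (lam2 t) - lo2 t + hi2 t = 0) ∧
    (grad (fun y => -(lf y)) (x (K+1)) - lam2 K = 0) ∧
    (∀ t, 1 ≤ t → t ≤ K → ∀ j, a1 t j ≤ u1 t j ∧ u1 t j ≤ b1 t j) ∧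
    (∀ t, 1 ≤ t → t ≤ K → ∀ j, a2 t j ≤ u2 t j ∧ u2 t j ≤ b2 t j) ∧
    (∀ t, 1 ≤ t → t ≤ K → ∀ j, 0 ≤ lo1 t j ∧ 0 ≤ hi1 t j) ∧
    (∀ t, 1 ≤ t → t ≤ K → ∀ j, 0 ≤ lo2 t j ∧ 0 ≤ hi2 t j) ∧
    (∀ t, 1 ≤ t → t ≤ K → ∀ j,
      lo1 t j * (u1 t j - a1 t j) = 0 ∧ hi1 t j * (b1 t j - u1 t j) = 0) ∧
    (∀ t, 1 ≤ t → t ≤ K → ∀ j,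
      lo2 t j * (u2 t j - a2 t j) = 0 ∧ hi2 t j * (b2 t j - u2 t j) = 0) := by
  have policy_terms : ∀ s, 2 ≤ s → s ≤ K → lam2 s = -lam1 s →
      jacT (pi2 s) (x s) (psi1 s) = 0 ∧ jacT (pi1 s) (x s) (psi2 s) = 0 := by
    intro s hs hsK hlam
    have hB1a := hFB1a s hs hsK
    have hB1b := hFB1b s hs hsK
    have hB2a := hFB2a s (by omega) hsK
    have hB2b := hFB2b s (by omega) hsK
    rw [hlam, jacT_neg, grad_fun_neg] at hB1b hB2b
    have hpsi1 : psi1 s = hi2 s - lo2 s := by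
      ext j
      have h1 := congrFun hB1a j
      have h2 := congrFun hB2b j
      simp only [Pi.add_apply, Pi.sub_apply, Pi.neg_apply, Pi.zero_apply] at h1 h2 ⊢
      linarith
    have hpsi2 : psi2 s = hi1 s - lo1 s := by
      ext j
      have h1 := congrFun hB1b j
      have h2 := congrFun hB2a j
      simp only [Pi.add_apply, Pi.sub_apply, Pi.neg_apply, Pi.zero_apply] at h1 h2 ⊢
      linarith
    rw [hpsi1, hpsi2]
    exact ⟨jacT_sub_eq_zero _ _ _ _ (hsc2 s hs hsK), jacT_sub_eq_zero _ _ _ _ (hsc1 s hs hsK)⟩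
  have costates_opposite : ∀ t, 1 ≤ t → t ≤ K → lam2 t = -lam1 t := by
    intro t ht htK
    induction htK using Nat.decreasingInduction with
    | self =>
      rw [grad_fun_neg] at hFB3b
      rw [← sub_eq_zero.mp hFB3a, ← sub_eq_zero.mp hFB3b]
    | of_succ s hsK ih =>
      have hlam := ih (by omega)
      obtain ⟨h1, h2⟩ := policy_terms (s + 1) (by omega) hsK hlam
      have hB4a := hFB4a (s + 1) (by omega) hsK
      have hB4b := hFB4b (s + 1) (by omega) hsK
      rw [h1, Nat.add_sub_cancel] at hB4a
      rw [h2, hlam, jacT_neg, grad_fun_neg, Nat.add_sub_cancel] at hB4b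
      ext j
      have h3 := congrFun hB4a j
      have h4 := congrFun hB4b j
      simp only [Pi.add_apply, Pi.sub_apply, Pi.neg_apply, Pi.zero_apply] at h3 h4 ⊢
      linarith
  refine ⟨fun t ht htK => ?_, hFB2a, hFB3a, fun t ht htK => ?_, hFB2b, hFB3b,
    hb1, hb2, hnn1, hnn2, hcp1, hcp2⟩
  · have h := hFB4a t ht htK
    rw [(policy_terms t ht htK (costates_opposite t (by omega) htK)).1, add_zero] at h
    rwa [add_sub_right_comm]
  · have h := hFB4b t ht htK
    rw [(policy_terms t ht htK (costates_opposite t (by omega) htK)).2, add_zero] at h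
    rwa [add_sub_right_comm]
end
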